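/- arXiv:2409.04589 — 2 statements merged into one kernel-verified Lean document; each statement's English description precedes it below -/
import Mathlib

section
/- (Lee bounds, continuous outcome.) Under the multilayered sample selection model with Assumptions RCT and LM, suppose P(D_0 > 0) > 0 and the conditional distribution of Y given {D > 0, Z = 1} is atomless, and set p := P(D>0 | Z=0) / P(D>0 | Z=1) and let q denote the quantile function of the conditional distribution of Y given {D>0, Z=1}. Then E[Y | D>0, Z=1, Y ≤ q(p)] − E[Y | D>0, Z=0] ≤ E[Y_{1,D_1} − Y_{0,D_0} | AE] ≤ E[Y | D>0, Z=1, Y ≥ q(1−p)] − E[Y | D>0, Z=0]. -/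
open MeasureTheory ProbabilityTheory

/-- Realized layer `D = D_1·Z + D_0·(1−Z)` (for `Z` valued in `{0,1}`). -/
def Dreal {Ω : Type*} (Z D0 D1 : Ω → ℕ) (ω : Ω) : ℕ :=
  D1 ω * Z ω + D0 ω * (1 - Z ω)

/-- Realized outcome `Y = Σ_{d=1}^K [Y_{1,d}·Z + Y_{0,d}·(1−Z)]·1{D=d}`. -/
noncomputable def Yreal {Ω : Type*} (K : ℕ) (Z D0 D1 : Ω → ℕ) (Y : ℕ → ℕ → Ω → ℝ)
    (ω : Ω) : ℝ :=
  ∑ d ∈ Finset.Icc 1 K,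
    (Y 1 d ω * (Z ω : ℝ) + Y 0 d ω * (1 - (Z ω : ℝ))) *
      (if Dreal Z D0 D1 ω = d then 1 else 0)

/-- `Y_{z,D_{z'}}(ω) = Σ_{d=1}^K Y_{z,d}(ω) · 1{D_{z'}(ω) = d}`. -/
noncomputable def YzD {Ω : Type*} (K : ℕ) (Y : ℕ → ℕ → Ω → ℝ) (z : ℕ) (Dz' : Ω → ℕ)
    (ω : Ω) : ℝ :=
  ∑ d ∈ Finset.Icc 1 K, Y z d ω * (if Dz' ω = d then 1 else 0)

/-- Assumption RCT: the σ-algebra generated by the potential outcomes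
`Y_{z,d}` (for `z ∈ {0,1}`, `d ∈ {1,…,K}`) together with `D_0, D_1` is
independent of (the σ-algebra generated by) `Z`. -/
def RCT {Ω : Type*} [MeasurableSpace Ω] (P : Measure Ω) (K : ℕ)
    (Y : ℕ → ℕ → Ω → ℝ) (D0 D1 Z : Ω → ℕ) : Prop :=
  Indep
    ((⨆ z ∈ ({0, 1} : Set ℕ), ⨆ d ∈ Set.Icc 1 K, MeasurableSpace.comap (Y z d) inferInstance)
      ⊔ MeasurableSpace.comap D0 inferInstance ⊔ MeasurableSpace.comap D1 inferInstance)
    (MeasurableSpace.comap Z inferInstance) P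

/-- Assumption LM (Lee's monotonicity): `P(1{D_1>0} ≥ 1{D_0>0}) = 1`. -/
def LM {Ω : Type*} [MeasurableSpace Ω] (P : Measure Ω) (D0 D1 : Ω → ℕ) : Prop :=
  P {ω | (if 0 < D0 ω then (1 : ℝ) else 0) ≤ (if 0 < D1 ω then (1 : ℝ) else 0)} = 1

/-- CDF of a random variable `W` under a measure `μ`. -/
noncomputable def cdfOf {Ω : Type*} [MeasurableSpace Ω] (μ : Measure Ω) (W : Ω → ℝ)
    (w : ℝ) : ℝ :=
  (μ {ω | W ω ≤ w}).toReal

/-- Quantile function `F⁻¹(u) = inf {w : F(w) ≥ u}`. -/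
noncomputable def quantileFn (F : ℝ → ℝ) (u : ℝ) : ℝ := sInf {w | u ≤ F w}

/-- If `{W ≤ q}` has positive probability not exceeding that of `S`, then the mean of `W` given
`W ≤ q` is at most its mean given `S`. -/
theorem integral_cond_le_integral_cond_of_measure_le {Ω : Type*} [MeasurableSpace Ω]
    {ν : Measure Ω} [IsProbabilityMeasure ν] {W : Ω → ℝ} (hW : Measurable W)
    (hWi : Integrable W ν) {S : Set Ω} (hS : MeasurableSet S) {q : ℝ}
    (h0 : ν {ω | W ω ≤ q} ≠ 0) (hle : ν {ω | W ω ≤ q} ≤ ν S) :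
    ∫ ω, W ω ∂(ν[|{ω | W ω ≤ q}]) ≤ ∫ ω, W ω ∂(ν[|S]) := by
  have hA : MeasurableSet {ω | W ω ≤ q} := measurableSet_le hW measurable_const
  have hS0 : ν S ≠ 0 := fun h => h0 (le_antisymm (h ▸ hle) zero_le)
  have hgi : Integrable (fun ω => W ω - q) ν := hWi.sub (integrable_const q)
  have shift : ∀ B : Set Ω, ν B ≠ 0 →
      ∫ ω, W ω ∂(ν[|B]) = (ν.real B)⁻¹ * ∫ ω in B, (W ω - q) ∂ν + q := by
    intro B hB
    have hB' : ν.real B ≠ 0 := by simpa [Measure.real, ENNReal.toReal_eq_zero_iff] using hB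
    rw [integral_sub hWi.integrableOn (integrable_const q).integrableOn]
    simp only [ProbabilityTheory.cond, integral_smul_measure, setIntegral_const, smul_eq_mul,
      ENNReal.toReal_inv]
    change (ν.real B)⁻¹ * _ = _
    field_simp
    ring
  have hrle : ν.real {ω | W ω ≤ q} ≤ ν.real S :=
    ENNReal.toReal_mono (measure_ne_top _ _) hle
  have hr0 : 0 < ν.real {ω | W ω ≤ q} := ENNReal.toReal_pos h0 (measure_ne_top _ _)
  have hneg : ∫ ω in {ω | W ω ≤ q}, (W ω - q) ∂ν ≤ 0 :=
    setIntegral_nonpos hA fun ω hω => sub_nonpos.2 hω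
  have hmono : ∫ ω in {ω | W ω ≤ q}, (W ω - q) ∂ν ≤ ∫ ω in S, (W ω - q) ∂ν := by
    have := setIntegral_nonpos_le (s := S) (f := fun ω => W ω - q) hS
      (hW.sub_const q).stronglyMeasurable hgi
    simpa only [sub_nonpos] using this
  rw [shift _ h0, shift _ hS0]
  have hinv : (ν.real S)⁻¹ ≤ (ν.real {ω | W ω ≤ q})⁻¹ := inv_anti₀ hr0 hrle
  have h1 := mul_le_mul_of_nonpos_right hinv hneg
  have h2 := mul_le_mul_of_nonneg_left hmono (inv_nonneg.2 (measureReal_nonneg (μ := ν) (s := S)))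
  linarith

theorem cdfOf_eq_cdf_map {Ω : Type*} [MeasurableSpace Ω] (ν : Measure Ω) [IsProbabilityMeasure ν]
    {W : Ω → ℝ} (hW : Measurable W) : cdfOf ν W = cdf (ν.map W) := by
  have := Measure.isProbabilityMeasure_map (μ := ν) hW.aemeasurable
  ext w
  rw [cdf_eq_real, map_measureReal_apply hW measurableSet_Iic]
  rfl

theorem continuous_cdfOf {Ω : Type*} [MeasurableSpace Ω] (ν : Measure Ω) [IsProbabilityMeasure ν]
    {W : Ω → ℝ} (hW : Measurable W) (hat : ∀ y, ν {ω | W ω = y} = 0) :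
    Continuous (cdfOf ν W) := by
  have := Measure.isProbabilityMeasure_map (μ := ν) hW.aemeasurable
  rw [cdfOf_eq_cdf_map ν hW, continuous_iff_continuousAt]
  intro y
  rw [(monotone_cdf _).continuousAt_iff_leftLim_eq_rightLim, StieltjesFunction.rightLim_eq]
  have h := (cdf (ν.map W)).measure_singleton y
  rw [measure_cdf, Measure.map_apply hW (measurableSet_singleton y)] at h
  have h' : ENNReal.ofReal (cdf (ν.map W) y - Function.leftLim (cdf (ν.map W)) y) = 0 := by
    rw [← h]; exact hat y
  exact le_antisymm ((monotone_cdf _).leftLim_le le_rfl)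
    (sub_nonpos.1 (ENNReal.ofReal_eq_zero.1 h'))

theorem le_cdfOf_quantileFn {Ω : Type*} [MeasurableSpace Ω] (ν : Measure Ω)
    [IsProbabilityMeasure ν] {W : Ω → ℝ} (hW : Measurable W) (hat : ∀ y, ν {ω | W ω = y} = 0)
    {u : ℝ} (hu : 0 < u) (hne : {w | u ≤ cdfOf ν W w}.Nonempty) :
    BddBelow {w | u ≤ cdfOf ν W w} ∧ u ≤ cdfOf ν W (quantileFn (cdfOf ν W) u) := by
  have hbdd : BddBelow {w | u ≤ cdfOf ν W w} := by
    have hlim := tendsto_cdf_atBot (ν.map W)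
    rw [← cdfOf_eq_cdf_map ν hW] at hlim
    obtain ⟨b, hb⟩ := Filter.eventually_atBot.1 (hlim.eventually_lt_const hu)
    exact ⟨b, fun w hw => le_of_not_gt fun h => absurd (hb w h.le) (not_lt.2 hw)⟩
  exact ⟨hbdd, (isClosed_le continuous_const (continuous_cdfOf ν hW hat)).csInf_mem hne hbdd⟩

theorem cdfOf_quantileFn {Ω : Type*} [MeasurableSpace Ω] (ν : Measure Ω)
    [IsProbabilityMeasure ν] {W : Ω → ℝ} (hW : Measurable W) (hat : ∀ y, ν {ω | W ω = y} = 0)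
    {u : ℝ} (hu : 0 < u) (hu1 : u < 1) : cdfOf ν W (quantileFn (cdfOf ν W) u) = u := by
  have hbot := tendsto_cdf_atBot (ν.map W)
  have htop := tendsto_cdf_atTop (ν.map W)
  have hmono := monotone_cdf (ν.map W)
  rw [← cdfOf_eq_cdf_map ν hW] at hbot htop hmono
  obtain ⟨w, hw⟩ := mem_range_of_exists_le_of_exists_ge (continuous_cdfOf ν hW hat)
    (hbot.eventually_le_const hu).exists (htop.eventually_const_le hu1).exists
  obtain ⟨hbdd, hle⟩ := le_cdfOf_quantileFn ν hW hat hu ⟨w, hw.ge⟩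
  exact le_antisymm ((hmono (csInf_le hbdd hw.ge)).trans hw.le) hle

/-- Lower trimming: among events of probability `ν S`, the lower tail of an atomless `W` has the
smallest conditional mean. -/
theorem integral_cond_lower_tail_le {Ω : Type*} [MeasurableSpace Ω] (ν : Measure Ω)
    [IsProbabilityMeasure ν] {W : Ω → ℝ} (hW : Measurable W) (hWi : Integrable W ν)
    (hat : ∀ y, ν {ω | W ω = y} = 0) {S : Set Ω} (hS : MeasurableSet S) (hS0 : ν S ≠ 0) :
    ∫ ω, W ω ∂(ν[|{ω | W ω ≤ quantileFn (cdfOf ν W) (ν S).toReal}]) ≤ ∫ ω, W ω ∂(ν[|S]) := by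
  set q := quantileFn (cdfOf ν W) (ν S).toReal with hq
  have hp0 : 0 < (ν S).toReal := ENNReal.toReal_pos hS0 (measure_ne_top _ _)
  have hle : ν {ω | W ω ≤ q} ≤ ν S := by
    rcases (prob_le_one (μ := ν) (s := S)).lt_or_eq with h1 | h1
    · have h := cdfOf_quantileFn ν hW hat hp0
        (by simpa using (ENNReal.toReal_lt_toReal (measure_ne_top _ _) ENNReal.one_ne_top).2 h1)
      exact ((ENNReal.toReal_eq_toReal_iff' (measure_ne_top _ _) (measure_ne_top _ _)).1 h).le
    · exact h1 ▸ prob_le_one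
  by_cases h0 : ν {ω | W ω ≤ q} = 0
  · have hemp : ¬ {w | (ν S).toReal ≤ cdfOf ν W w}.Nonempty := fun hne => by
      have h := (le_cdfOf_quantileFn ν hW hat hp0 hne).2
      rw [← hq, cdfOf, h0, ENNReal.toReal_zero] at h
      exact absurd hp0 (not_lt.2 h)
    have hq0 : q = 0 := by
      rw [hq, quantileFn, Set.not_nonempty_iff_eq_empty.1 hemp, Real.sInf_empty]
    rw [cond_eq_zero_of_meas_eq_zero h0, integral_zero_measure]
    refine integral_nonneg_of_ae (cond_absolutelyContinuous.ae_le ?_)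
    rw [hq0] at h0
    have : ∀ᵐ ω ∂ν, ¬ W ω ≤ 0 := measure_eq_zero_iff_ae_notMem.1 h0
    filter_upwards [this] with ω hω using (not_le.1 hω).le
  · exact integral_cond_le_integral_cond_of_measure_le hW hWi hS h0 hle

/-- Upper trimming: among events of probability `ν S`, the upper tail of an atomless `W` has the
largest conditional mean. -/
theorem le_integral_cond_upper_tail {Ω : Type*} [MeasurableSpace Ω] (ν : Measure Ω)
    [IsProbabilityMeasure ν] {W : Ω → ℝ} (hW : Measurable W) (hWi : Integrable W ν)
    (hat : ∀ y, ν {ω | W ω = y} = 0) {S : Set Ω} (hS : MeasurableSet S) (hS0 : ν S ≠ 0) :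
    ∫ ω, W ω ∂(ν[|S]) ≤
      ∫ ω, W ω ∂(ν[|{ω | quantileFn (cdfOf ν W) (1 - (ν S).toReal) ≤ W ω}]) := by
  set q := quantileFn (cdfOf ν W) (1 - (ν S).toReal) with hq
  have hp0 : 0 < (ν S).toReal := ENNReal.toReal_pos hS0 (measure_ne_top _ _)
  have hneg : {ω | -W ω ≤ -q} = {ω | q ≤ W ω} := by ext; simp
  have key (h0 : ν {ω | q ≤ W ω} ≠ 0) (hle : ν {ω | q ≤ W ω} ≤ ν S) :
      ∫ ω, W ω ∂(ν[|S]) ≤ ∫ ω, W ω ∂(ν[|{ω | q ≤ W ω}]) := by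
    have h := integral_cond_le_integral_cond_of_measure_le (q := -q) hW.neg hWi.neg hS
      (by simpa using h0) (by simpa using hle)
    simp only [Pi.neg_apply, hneg, integral_neg] at h
    linarith
  rcases (prob_le_one (μ := ν) (s := S)).lt_or_eq with h1 | h1
  · have hp1 : (ν S).toReal < 1 := by
      simpa using (ENNReal.toReal_lt_toReal (measure_ne_top _ _) ENNReal.one_ne_top).2 h1
    have hF : ν.real {ω | W ω ≤ q} = 1 - (ν S).toReal :=
      cdfOf_quantileFn ν hW hat (by linarith) (by linarith)
    have hc : {ω | W ω ≤ q}ᶜ = {ω | q < W ω} := by ext; simp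
    have hlt : ν {ω | q < W ω} = ν S := by
      have h := probReal_compl_eq_one_sub (μ := ν) (measurableSet_le hW (measurable_const (a := q)))
      rw [hF, hc, sub_sub_cancel] at h
      exact (ENNReal.toReal_eq_toReal_iff' (measure_ne_top _ _) (measure_ne_top _ _)).1 h
    have hae : ν {ω | q ≤ W ω} = ν {ω | q < W ω} := by
      refine measure_congr ?_
      have : ∀ᵐ ω ∂ν, ¬ W ω = q := measure_eq_zero_iff_ae_notMem.1 (hat q)
      filter_upwards [this] with ω hω
      exact propext ⟨fun h => lt_of_le_of_ne h (Ne.symm hω), le_of_lt⟩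
    rw [hlt] at hae
    exact key (hae ▸ hS0) hae.le
  · by_cases h0 : ν {ω | q ≤ W ω} = 0
    · have hq0 : q = 0 := by
        have huniv : {w | 1 - (ν S).toReal ≤ cdfOf ν W w} = Set.univ := by
          ext w; simp [h1, cdfOf]
        rw [hq, quantileFn, huniv, Real.sInf_univ]
      rw [cond_eq_zero_of_meas_eq_zero h0, integral_zero_measure]
      refine integral_nonpos_of_ae (cond_absolutelyContinuous.ae_le ?_)
      rw [hq0] at h0
      have : ∀ᵐ ω ∂ν, ¬ 0 ≤ W ω := measure_eq_zero_iff_ae_notMem.1 h0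
      filter_upwards [this] with ω hω using (not_le.1 hω).le
    · exact key h0 (h1 ▸ prob_le_one)

/-- Conditioning additionally on an independent event does not change conditional
probabilities. -/
theorem cond_inter_apply_of_indep {Ω : Type*} {m₁ m₂ m : MeasurableSpace Ω} {P : Measure Ω}
    [IsProbabilityMeasure P] (hm₁ : m₁ ≤ m) (hm₂ : m₂ ≤ m) (hind : Indep m₁ m₂ P)
    {A B C : Set Ω} (hA : MeasurableSet[m₁] A) (hB : MeasurableSet[m₂] B) (hB0 : P B ≠ 0)
    (hC : MeasurableSet[m₁] C) : (P[|A ∩ B]) C = (P[|A]) C := by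
  have hi := (Indep_iff m₁ m₂ P).1 hind
  rw [cond_apply ((hm₁ _ hA).inter (hm₂ _ hB)), cond_apply (hm₁ _ hA), Set.inter_right_comm,
    hi _ _ hA hB, hi _ _ (hA.inter hC) hB,
    ENNReal.mul_inv (Or.inr (measure_ne_top _ _)) (Or.inr hB0), mul_mul_mul_comm,
    ENNReal.inv_mul_cancel hB0 (measure_ne_top _ _), mul_one]

/-- Conditioning additionally on an independent event does not change conditional means. -/
theorem integral_cond_inter_of_indep {Ω : Type*} {m₁ m₂ m : MeasurableSpace Ω} {P : Measure Ω}
    [IsProbabilityMeasure P] (hm₁ : m₁ ≤ m) (hm₂ : m₂ ≤ m) (hind : Indep m₁ m₂ P)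
    {A B : Set Ω} (hA : MeasurableSet[m₁] A) (hB : MeasurableSet[m₂] B) (hB0 : P B ≠ 0)
    {f : Ω → ℝ} (hf : Measurable[m₁] f) :
    ∫ ω, f ω ∂(P[|A ∩ B]) = ∫ ω, f ω ∂(P[|A]) := by
  rw [integral_trim hm₁ hf.stronglyMeasurable, integral_trim hm₁ hf.stronglyMeasurable]
  congr 1
  refine @Measure.ext _ m₁ _ _ fun C hC => ?_
  rw [trim_measurableSet_eq hm₁ hC, trim_measurableSet_eq hm₁ hC,
    cond_inter_apply_of_indep hm₁ hm₂ hind hA hB hB0 hC]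

/-- The σ-algebra generated by the potential outcomes and the potential layers. -/
@[reducible]
def potentialSigma {Ω : Type*} (K : ℕ) (Y : ℕ → ℕ → Ω → ℝ) (D0 D1 : Ω → ℕ) :
    MeasurableSpace Ω :=
  (⨆ z ∈ ({0, 1} : Set ℕ), ⨆ d ∈ Set.Icc 1 K, MeasurableSpace.comap (Y z d) inferInstance)
    ⊔ MeasurableSpace.comap D0 inferInstance ⊔ MeasurableSpace.comap D1 inferInstance

theorem measurable_potentialSigma_outcome {Ω : Type*} {K : ℕ} {Y : ℕ → ℕ → Ω → ℝ}
    {D0 D1 : Ω → ℕ} {z d : ℕ} (hz : z ∈ ({0, 1} : Set ℕ)) (hd : d ∈ Finset.Icc 1 K) :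
    Measurable[potentialSigma K Y D0 D1] (Y z d) := by
  refine measurable_iff_comap_le.2 (le_trans ?_ (le_sup_left.trans le_sup_left))
  exact le_trans (le_iSup₂_of_le d (by simpa using hd) le_rfl)
    (le_iSup₂ (f := fun z (_ : z ∈ ({0, 1} : Set ℕ)) => ⨆ d ∈ Set.Icc 1 K,
      MeasurableSpace.comap (Y z d) inferInstance) z hz)

theorem potentialSigma_le {Ω : Type*} [m : MeasurableSpace Ω] {K : ℕ} {Y : ℕ → ℕ → Ω → ℝ}
    {D0 D1 : Ω → ℕ} (hY : ∀ z ≤ 1, ∀ d, 1 ≤ d → d ≤ K → Measurable (Y z d))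
    (hD0 : Measurable D0) (hD1 : Measurable D1) : potentialSigma K Y D0 D1 ≤ m := by
  refine sup_le (sup_le (iSup₂_le fun z hz => iSup₂_le fun d hd => ?_) hD0.comap_le)
    hD1.comap_le
  refine (hY z ?_ d hd.1 hd.2).comap_le
  rcases hz with rfl | rfl <;> simp

theorem Dreal_of_eq_one {Ω : Type*} {Z D0 D1 : Ω → ℕ} {ω : Ω} (h : Z ω = 1) :
    Dreal Z D0 D1 ω = D1 ω := by
  simp [Dreal, h]

theorem Dreal_of_eq_zero {Ω : Type*} {Z D0 D1 : Ω → ℕ} {ω : Ω} (h : Z ω = 0) :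
    Dreal Z D0 D1 ω = D0 ω := by
  simp [Dreal, h]

theorem Yreal_of_eq_one {Ω : Type*} {K : ℕ} {Z D0 D1 : Ω → ℕ} {Y : ℕ → ℕ → Ω → ℝ} {ω : Ω}
    (h : Z ω = 1) : Yreal K Z D0 D1 Y ω = YzD K Y 1 D1 ω := by
  simp [Yreal, YzD, Dreal_of_eq_one h, h]

theorem Yreal_of_eq_zero {Ω : Type*} {K : ℕ} {Z D0 D1 : Ω → ℕ} {Y : ℕ → ℕ → Ω → ℝ} {ω : Ω}
    (h : Z ω = 0) : Yreal K Z D0 D1 Y ω = YzD K Y 0 D0 ω := by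
  simp [Yreal, YzD, Dreal_of_eq_zero h, h]

theorem measurable_YzD {Ω : Type*} [MeasurableSpace Ω] {K : ℕ} {Y : ℕ → ℕ → Ω → ℝ} {z : ℕ}
    {D : Ω → ℕ} (hY : ∀ d ∈ Finset.Icc 1 K, Measurable (Y z d)) (hD : Measurable D) :
    Measurable (YzD K Y z D) :=
  Finset.measurable_fun_sum _ fun d hd => (hY d hd).mul <|
    Measurable.ite (hD (measurableSet_singleton d)) measurable_const measurable_const

theorem integrable_YzD {Ω : Type*} [MeasurableSpace Ω] {P : Measure Ω} {K : ℕ}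
    {Y : ℕ → ℕ → Ω → ℝ} {z : ℕ} {D : Ω → ℕ}
    (hY : ∀ d ∈ Finset.Icc 1 K, Integrable (Y z d) P) (hD : Measurable D) :
    Integrable (YzD K Y z D) P := by
  refine integrable_finsetSum _ fun d hd => ?_
  refine ((hY d hd).indicator (hD (measurableSet_singleton d))).congr (ae_of_all _ fun ω => ?_)
  by_cases h : D ω = d <;> simp [Set.indicator, h]

/-- Lee bounds, continuous outcome. -/
theorem lee_bounds_continuous
    {Ω : Type*} [MeasurableSpace Ω] (P : Measure Ω) [IsProbabilityMeasure P]
    (K : ℕ) (hK : 1 ≤ K)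
    (Z D0 D1 : Ω → ℕ)
    (hZm : Measurable Z) (hD0m : Measurable D0) (hD1m : Measurable D1)
    (hZ01 : ∀ ω, Z ω ≤ 1) (hD0K : ∀ ω, D0 ω ≤ K) (hD1K : ∀ ω, D1 ω ≤ K)
    (hZpos : 0 < P {ω | Z ω = 1}) (hZlt : P {ω | Z ω = 1} < 1)
    (Y : ℕ → ℕ → Ω → ℝ)
    (hYm : ∀ z ≤ 1, ∀ d, 1 ≤ d → d ≤ K → Measurable (Y z d))
    (hYint : ∀ z ≤ 1, ∀ d, 1 ≤ d → d ≤ K → Integrable (Y z d) P)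
    (hRCT : RCT P K Y D0 D1 Z) (hLM : LM P D0 D1)
    (hD0pos : 0 < P {ω | 0 < D0 ω})
    (hAtomless : ∀ y : ℝ,
      (P[|{ω | 0 < Dreal Z D0 D1 ω ∧ Z ω = 1}]) {ω | Yreal K Z D0 D1 Y ω = y} = 0) :
    ((∫ ω, Yreal K Z D0 D1 Y ω
        ∂(P[|{ω | 0 < Dreal Z D0 D1 ω ∧ Z ω = 1 ∧
            Yreal K Z D0 D1 Y ω ≤
              quantileFn (cdfOf (P[|{ω | 0 < Dreal Z D0 D1 ω ∧ Z ω = 1}]) (Yreal K Z D0 D1 Y))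
                (((P[|{ω | Z ω = 0}]) {ω | 0 < Dreal Z D0 D1 ω}).toReal /
                  ((P[|{ω | Z ω = 1}]) {ω | 0 < Dreal Z D0 D1 ω}).toReal)}]))
      - (∫ ω, Yreal K Z D0 D1 Y ω ∂(P[|{ω | 0 < Dreal Z D0 D1 ω ∧ Z ω = 0}]))
      ≤ ∫ ω, (YzD K Y 1 D1 ω - YzD K Y 0 D0 ω) ∂(P[|{ω | 0 < D0 ω ∧ 0 < D1 ω}]))
    ∧ (∫ ω, (YzD K Y 1 D1 ω - YzD K Y 0 D0 ω) ∂(P[|{ω | 0 < D0 ω ∧ 0 < D1 ω}])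
      ≤ (∫ ω, Yreal K Z D0 D1 Y ω
          ∂(P[|{ω | 0 < Dreal Z D0 D1 ω ∧ Z ω = 1 ∧
              quantileFn (cdfOf (P[|{ω | 0 < Dreal Z D0 D1 ω ∧ Z ω = 1}]) (Yreal K Z D0 D1 Y))
                (1 - ((P[|{ω | Z ω = 0}]) {ω | 0 < Dreal Z D0 D1 ω}).toReal /
                  ((P[|{ω | Z ω = 1}]) {ω | 0 < Dreal Z D0 D1 ω}).toReal)
                ≤ Yreal K Z D0 D1 Y ω}]))
        - (∫ ω, Yreal K Z D0 D1 Y ω ∂(P[|{ω | 0 < Dreal Z D0 D1 ω ∧ Z ω = 0}]))) := by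
  set W1 := YzD K Y 1 D1
  set W0 := YzD K Y 0 D0
  have hD0m₁ : Measurable[potentialSigma K Y D0 D1] D0 :=
    measurable_iff_comap_le.2 (le_sup_right.trans le_sup_left)
  have hD1m₁ : Measurable[potentialSigma K Y D0 D1] D1 := measurable_iff_comap_le.2 le_sup_right
  have hm₁ := potentialSigma_le hYm hD0m hD1m
  have hind : Indep (potentialSigma K Y D0 D1) (MeasurableSpace.comap Z inferInstance) P := hRCT
  have hW1m₁ : Measurable[potentialSigma K Y D0 D1] W1 :=
    @measurable_YzD _ (potentialSigma K Y D0 D1) _ _ _ _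
      (fun _ hd => measurable_potentialSigma_outcome (by simp) hd) hD1m₁
  have hW0m₁ : Measurable[potentialSigma K Y D0 D1] W0 :=
    @measurable_YzD _ (potentialSigma K Y D0 D1) _ _ _ _
      (fun _ hd => measurable_potentialSigma_outcome (by simp) hd) hD0m₁
  have hW1 : Measurable W1 := hW1m₁.mono hm₁ le_rfl
  have hW1i : Integrable W1 P := integrable_YzD (fun d hd => hYint 1 le_rfl d
    (Finset.mem_Icc.1 hd).1 (Finset.mem_Icc.1 hd).2) hD1m
  have hW0i : Integrable W0 P := integrable_YzD (fun d hd => hYint 0 zero_le_one d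
    (Finset.mem_Icc.1 hd).1 (Finset.mem_Icc.1 hd).2) hD0m
  have hZmeas (z : ℕ) : MeasurableSet[MeasurableSpace.comap Z inferInstance] {ω | Z ω = z} :=
    ⟨{z}, measurableSet_singleton z, rfl⟩
  have hZ1 : P {ω | Z ω = 1} ≠ 0 := hZpos.ne'
  have hZ0 : P {ω | Z ω = 0} ≠ 0 := by
    intro h
    have hc : {ω | Z ω = 0} = {ω | Z ω = 1}ᶜ := by
      ext ω
      have := hZ01 ω
      simp only [Set.mem_ofPred_eq, Set.mem_compl_iff]
      omega
    rw [hc] at h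
    exact hZlt.ne ((prob_compl_eq_zero_iff (hZm (measurableSet_singleton 1))).1 h)
  have hWC {C : Set ℝ} (hC : MeasurableSet C) :
      MeasurableSet[potentialSigma K Y D0 D1] {ω | W1 ω ∈ C} := hW1m₁ hC
  have hA1 : MeasurableSet[potentialSigma K Y D0 D1] {ω | 0 < D1 ω} := hD1m₁ measurableSet_Ioi
  have hA0 : MeasurableSet[potentialSigma K Y D0 D1] {ω | 0 < D0 ω} := hD0m₁ measurableSet_Ioi
  -- Transfer from the realized variables to the potential ones.
  have transfer (z : ℕ) (hz : P {ω | Z ω = z} ≠ 0) {A : Set Ω} (hA : MeasurableSet[potentialSigma K Y D0 D1] A)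
      {f : Ω → ℝ} (hf : Measurable[potentialSigma K Y D0 D1] f) (hYf : ∀ ω, Z ω = z → Yreal K Z D0 D1 Y ω = f ω) :
      ∫ ω, Yreal K Z D0 D1 Y ω ∂(P[|A ∩ {ω | Z ω = z}]) = ∫ ω, f ω ∂(P[|A]) := by
    rw [← integral_cond_inter_of_indep hm₁ hZm.comap_le hind hA (hZmeas z) hz hf]
    refine integral_congr_ae ?_
    filter_upwards [ae_cond_mem ((hm₁ _ hA).inter (hZm (measurableSet_singleton z)))]
      with ω hω using hYf ω hω.2
  have transfer_set {C : Set ℝ} (hC : MeasurableSet C) :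
      (P[|{ω | 0 < Dreal Z D0 D1 ω ∧ Z ω = 1}]) {ω | Yreal K Z D0 D1 Y ω ∈ C} =
        (P[|{ω | 0 < D1 ω}]) {ω | W1 ω ∈ C} := by
    have hset : {ω | 0 < Dreal Z D0 D1 ω ∧ Z ω = 1} = {ω | 0 < D1 ω} ∩ {ω | Z ω = 1} := by
      ext ω
      exact and_congr_left fun h => by rw [Dreal_of_eq_one h]; rfl
    rw [hset, ← cond_inter_apply_of_indep hm₁ hZm.comap_le hind hA1 (hZmeas 1) hZ1 (hWC hC)]
    refine measure_congr ?_
    filter_upwards [ae_cond_mem ((hm₁ _ hA1).inter (hZm (measurableSet_singleton 1)))] with ω hω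
    change (Yreal K Z D0 D1 Y ω ∈ C) = (W1 ω ∈ C)
    rw [Yreal_of_eq_one hω.2]
  have prob_D (z : ℕ) (hz : P {ω | Z ω = z} ≠ 0) {D : Ω → ℕ} (hD : Measurable[potentialSigma K Y D0 D1] D)
      (hDD : ∀ ω, Z ω = z → Dreal Z D0 D1 ω = D ω) :
      (P[|{ω | Z ω = z}]) {ω | 0 < Dreal Z D0 D1 ω} = P {ω | 0 < D ω} := by
    have hDm : MeasurableSet[potentialSigma K Y D0 D1] {ω | 0 < D ω} := hD measurableSet_Ioi
    have h := cond_inter_apply_of_indep hm₁ hZm.comap_le hind MeasurableSet.univ (hZmeas z) hz hDm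
    rw [Set.univ_inter, cond_univ] at h
    rw [← h]
    refine measure_congr ?_
    filter_upwards [ae_cond_mem (hZm (measurableSet_singleton z))] with ω hω
    change (0 < Dreal Z D0 D1 ω) = (0 < D ω)
    rw [hDD ω hω]
  set ν := P[|{ω | 0 < D1 ω}] with hν
  -- Monotonicity.
  have hmono : ∀ᵐ ω ∂P, 0 < D0 ω → 0 < D1 ω := by
    have hms : MeasurableSet
        {ω | (if 0 < D0 ω then (1 : ℝ) else 0) ≤ (if 0 < D1 ω then (1 : ℝ) else 0)} :=
      measurableSet_le (Measurable.ite (hm₁ _ hA0) measurable_const measurable_const)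
        (Measurable.ite (hm₁ _ hA1) measurable_const measurable_const)
    filter_upwards [(mem_ae_iff_prob_eq_one hms).2 hLM] with ω hω h0
    by_contra h1
    have hω' : (if 0 < D0 ω then (1 : ℝ) else 0) ≤ (if 0 < D1 ω then (1 : ℝ) else 0) := hω
    rw [if_pos h0, if_neg h1] at hω'
    exact absurd hω' (by norm_num)
  have hAE : ({ω | 0 < D0 ω ∧ 0 < D1 ω} : Set Ω) =ᵐ[P] {ω | 0 < D0 ω} := by
    filter_upwards [hmono] with ω hω
    exact propext ⟨fun h => h.1, fun h => ⟨h, hω h⟩⟩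
  have hinter : {ω | 0 < D1 ω} ∩ {ω | 0 < D0 ω} = {ω | 0 < D0 ω ∧ 0 < D1 ω} :=
    Set.inter_comm _ _
  have hAE0 : P {ω | 0 < D0 ω ∧ 0 < D1 ω} ≠ 0 := by rw [measure_congr hAE]; exact hD0pos.ne'
  have hD1pos : P {ω | 0 < D1 ω} ≠ 0 := fun h =>
    hAE0 (measure_mono_null (fun _ hω => hω.2) h)
  have : IsProbabilityMeasure ν := cond_isProbabilityMeasure hD1pos
  have hνS : ν {ω | 0 < D0 ω} = (P {ω | 0 < D1 ω})⁻¹ * P {ω | 0 < D0 ω} := by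
    rw [hν, cond_apply (hm₁ _ hA1), hinter, measure_congr hAE]
  have hνS0 : ν {ω | 0 < D0 ω} ≠ 0 := by
    rw [hνS]
    exact mul_ne_zero (ENNReal.inv_ne_zero.2 (measure_ne_top _ _)) hD0pos.ne'
  have hp : ((P[|{ω | Z ω = 0}]) {ω | 0 < Dreal Z D0 D1 ω}).toReal /
      ((P[|{ω | Z ω = 1}]) {ω | 0 < Dreal Z D0 D1 ω}).toReal = (ν {ω | 0 < D0 ω}).toReal := by
    rw [prob_D 0 hZ0 hD0m₁ fun _ h => Dreal_of_eq_zero h,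
      prob_D 1 hZ1 hD1m₁ fun _ h => Dreal_of_eq_one h, hνS, ENNReal.toReal_mul,
      ENNReal.toReal_inv, div_eq_inv_mul]
  have hcdf : cdfOf (P[|{ω | 0 < Dreal Z D0 D1 ω ∧ Z ω = 1}]) (Yreal K Z D0 D1 Y) =
      cdfOf ν W1 := by
    ext w
    exact congrArg ENNReal.toReal (transfer_set (measurableSet_Iic (a := w)))
  have hat (y : ℝ) : ν {ω | W1 ω = y} = 0 :=
    (transfer_set (measurableSet_singleton y)).symm.trans (hAtomless y)
  have hW1ν : Integrable W1 ν := hW1i.restrict.smul_measure (ENNReal.inv_ne_top.2 hD1pos)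
  have hcond_AE : P[|{ω | 0 < D0 ω ∧ 0 < D1 ω}] = ν[|{ω | 0 < D0 ω}] := by
    rw [hν, cond_cond_eq_cond_inter (hm₁ _ hA1) (hm₁ _ hA0), hinter]
  have hcond_D0 : P[|{ω | 0 < D0 ω ∧ 0 < D1 ω}] = P[|{ω | 0 < D0 ω}] := by
    rw [ProbabilityTheory.cond, ProbabilityTheory.cond, measure_congr hAE,
      Measure.restrict_congr_set hAE]
  have hmid : ∫ ω, (W1 ω - W0 ω) ∂(P[|{ω | 0 < D0 ω ∧ 0 < D1 ω}]) =
      ∫ ω, W1 ω ∂(ν[|{ω | 0 < D0 ω}]) - ∫ ω, W0 ω ∂(P[|{ω | 0 < D0 ω}]) := by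
    have hi {f : Ω → ℝ} (hf : Integrable f P) :
        Integrable f (P[|{ω | 0 < D0 ω ∧ 0 < D1 ω}]) :=
      hf.restrict.smul_measure (ENNReal.inv_ne_top.2 hAE0)
    rw [integral_sub (hi hW1i) (hi hW0i)]
    rw [← hcond_AE, ← hcond_D0]
  have hctrl : ∫ ω, Yreal K Z D0 D1 Y ω ∂(P[|{ω | 0 < Dreal Z D0 D1 ω ∧ Z ω = 0}]) =
      ∫ ω, W0 ω ∂(P[|{ω | 0 < D0 ω}]) := by
    have hset : {ω | 0 < Dreal Z D0 D1 ω ∧ Z ω = 0} = {ω | 0 < D0 ω} ∩ {ω | Z ω = 0} := by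
      ext ω
      exact and_congr_left fun h => by rw [Dreal_of_eq_zero h]; rfl
    rw [hset, transfer 0 hZ0 hA0 hW0m₁ fun _ h => Yreal_of_eq_zero h]
  have htail {C : Set ℝ} (hC : MeasurableSet C) :
      ∫ ω, Yreal K Z D0 D1 Y ω
        ∂(P[|{ω | 0 < Dreal Z D0 D1 ω ∧ Z ω = 1 ∧ Yreal K Z D0 D1 Y ω ∈ C}]) =
      ∫ ω, W1 ω ∂(ν[|{ω | W1 ω ∈ C}]) := by
    have hset : {ω | 0 < Dreal Z D0 D1 ω ∧ Z ω = 1 ∧ Yreal K Z D0 D1 Y ω ∈ C} =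
        ({ω | 0 < D1 ω} ∩ {ω | W1 ω ∈ C}) ∩ {ω | Z ω = 1} := by
      ext ω
      simp only [Set.mem_ofPred_eq, Set.mem_inter_iff]
      constructor
      · rintro ⟨h1, h2, h3⟩
        rw [Dreal_of_eq_one h2] at h1
        rw [Yreal_of_eq_one h2] at h3
        exact ⟨⟨h1, h3⟩, h2⟩
      · rintro ⟨⟨h1, h3⟩, h2⟩
        rw [Dreal_of_eq_one h2, Yreal_of_eq_one h2]
        exact ⟨h1, h2, h3⟩
    rw [hset, transfer 1 hZ1 (hA1.inter (hWC hC)) hW1m₁ fun _ h => Yreal_of_eq_one h, hν,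
      cond_cond_eq_cond_inter (hm₁ _ hA1) (hm₁ _ (hWC hC))]
  rw [hp, hcdf, hmid, hctrl]
  constructor
  · refine sub_le_sub_right ((htail measurableSet_Iic).trans_le ?_) _
    exact integral_cond_lower_tail_le ν hW1 hW1ν hat (hm₁ _ hA0) hνS0
  · refine sub_le_sub_right (le_of_le_of_eq ?_ (htail measurableSet_Ici).symm) _
    exact le_integral_cond_upper_tail ν hW1 hW1ν hat (hm₁ _ hA0) hνS0
end

section
/- (Sharp characterization of response-type probabilities.) Let μ be a probability distribution for (Y, D, Z) on ℝ × {0,…,K} × {0,1} with 0 < μ(Z=1) < 1. Let p = (p_{(d,d')})_{(d,d') ∈ {0,…,K}²} be any vector with p_{(d,d')} ≥ 0, Σ_{(d,d')} p_{(d,d')} = 1, satisfying μ(D=d | Z=1) = Σ_{d'=0}^{K} p_{(d',d)} and μ(D=d | Z=0) = Σ_{d'=0}^{K} p_{(d,d')} for every d ∈ {0,…,K}. Then there exists a probability space carrying random variables (Y_{z,d})_{z∈{0,1}, d∈{1,…,K}}, D_0, D_1, Z satisfying Assumption RCT, with P(D_0 = d, D_1 = d') = p_{(d,d')} for all (d,d'),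 and such that the induced variables D := D_1·Z + D_0·(1−Z) and Y := Σ_{d=1}^K [Y_{1,d}·Z + Y_{0,d}·(1−Z)]·1{D=d} satisfy: (D,Z) has the same joint distribution as under μ, and for every d ∈ {1,…,K} and z ∈ {0,1} the joint distribution of (Y, D=d, Z=z) coincides with that under μ. -/
open MeasureTheory ProbabilityTheory

/-- A conditional law of `X` given `s`, with an arbitrary value when `s` is null. -/
theorem exists_isProbabilityMeasure_mul_eq_inter {α β : Type*} [MeasurableSpace α]
    [MeasurableSpace β] [Nonempty β] (μ : Measure α) [IsFiniteMeasure μ] {X : α → β}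
    (hX : Measurable X) {s : Set α} (hs : MeasurableSet s) :
    ∃ κ : Measure β, IsProbabilityMeasure κ ∧
      ∀ A, MeasurableSet A → κ A * μ s = μ (s ∩ X ⁻¹' A) := by
  by_cases h : μ s = 0
  · refine ⟨Measure.dirac (Classical.arbitrary β), inferInstance, fun A _ => ?_⟩
    rw [h, mul_zero, measure_mono_null Set.inter_subset_left h]
  · have := cond_isProbabilityMeasure h
    refine ⟨(μ[|s]).map X, Measure.isProbabilityMeasure_map hX.aemeasurable, fun A hA => ?_⟩
    rw [Measure.map_apply hX hA, cond_mul_eq_inter hs]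

/-- The measure on `α` giving each `t ∈ s` the mass `p t`. -/
noncomputable def weightedDirac {α : Type*} [MeasurableSpace α] (s : Finset α) (p : α → ℝ) :
    Measure α :=
  ∑ t ∈ s, ENNReal.ofReal (p t) • Measure.dirac t

theorem weightedDirac_apply {α : Type*} [MeasurableSpace α] [DiscreteMeasurableSpace α]
    {s : Finset α} {p : α → ℝ} (hp : ∀ t ∈ s, 0 ≤ p t) (A : Set α) [DecidablePred (· ∈ A)] :
    weightedDirac s p A = ENNReal.ofReal (∑ t ∈ s with t ∈ A, p t) := by
  rw [ENNReal.ofReal_sum_of_nonneg fun t ht => hp t (Finset.mem_filter.1 ht).1,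
    Finset.sum_filter]
  simp only [weightedDirac, Measure.coe_finsetSum, Finset.sum_apply, Measure.smul_apply,
    Measure.dirac_apply, smul_eq_mul]
  exact Finset.sum_congr rfl fun t _ => by by_cases h : t ∈ A <;> simp [h]

theorem isProbabilityMeasure_weightedDirac {α : Type*} [MeasurableSpace α]
    [DiscreteMeasurableSpace α] {s : Finset α} {p : α → ℝ} (hp : ∀ t ∈ s, 0 ≤ p t)
    (hp1 : ∑ t ∈ s, p t = 1) : IsProbabilityMeasure (weightedDirac s p) := by
  classical
  exact ⟨by rw [weightedDirac_apply hp]; simp [hp1]⟩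

/-- The realized layer of the response type `t = (D_0, D_1)` under the assignment `z`. -/
def responseLayer (z : ℕ) (t : ℕ × ℕ) : ℕ :=
  if z = 0 then t.1 else t.2

theorem Dreal_eq_responseLayer {Ω : Type*} {Z D0 D1 : Ω → ℕ} {ω : Ω} {z : ℕ} (hz : z ≤ 1)
    (h : Z ω = z) : Dreal Z D0 D1 ω = responseLayer z (D0 ω, D1 ω) := by
  interval_cases z <;> simp [Dreal, responseLayer, h]

theorem Yreal_eq {Ω : Type*} {K : ℕ} {Z D0 D1 : Ω → ℕ} {Y : ℕ → ℕ → Ω → ℝ} {ω : Ω} {d z : ℕ}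
    (hd : d ∈ Finset.Icc 1 K) (hz : z ≤ 1) (hZ : Z ω = z) (hD : Dreal Z D0 D1 ω = d) :
    Yreal K Z D0 D1 Y ω = Y z d ω := by
  rw [Yreal, Finset.sum_eq_single_of_mem d hd fun e _ he => by simp [hD, he.symm]]
  interval_cases z <;> simp [hZ, hD]

theorem weightedDirac_responseLayer {K : ℕ} {p : ℕ × ℕ → ℝ}
    (hp0 : ∀ t ∈ Finset.range (K + 1) ×ˢ Finset.range (K + 1), 0 ≤ p t)
    {d z : ℕ} (hd : d ≤ K) :
    weightedDirac (Finset.range (K + 1) ×ˢ Finset.range (K + 1)) p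
        {t | responseLayer z (min t.1 K, min t.2 K) = d} =
      ENNReal.ofReal (if z = 0 then ∑ e ∈ Finset.range (K + 1), p (d, e)
        else ∑ e ∈ Finset.range (K + 1), p (e, d)) := by
  rw [weightedDirac_apply hp0]
  congr 1
  have hd' : d ∈ Finset.range (K + 1) := Finset.mem_range.2 (by omega)
  have hmin : ∀ a ∈ Finset.range (K + 1), min a K = a := fun a ha =>
    min_eq_left (Nat.lt_succ_iff.1 (Finset.mem_range.1 ha))
  rw [Finset.sum_filter]
  split_ifs with hz
  · rw [Finset.sum_product, Finset.sum_eq_single_of_mem d hd']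
    · exact Finset.sum_congr rfl fun e _ => by simp [responseLayer, hz, hd]
    · intro a ha hne
      exact Finset.sum_eq_zero fun e _ => by simp [responseLayer, hz, hmin a ha, hne]
  · rw [Finset.sum_product_right, Finset.sum_eq_single_of_mem d hd']
    · exact Finset.sum_congr rfl fun e _ => by simp [responseLayer, hz, hd]
    · intro a ha hne
      exact Finset.sum_eq_zero fun e _ => by simp [responseLayer, hz, hmin a ha, hne]

theorem RCT_of_prod {α β : Type*} [MeasurableSpace α] [MeasurableSpace β] (P : Measure α)
    (Q : Measure β) [IsProbabilityMeasure P] [IsProbabilityMeasure Q] (K : ℕ)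
    {Y : ℕ → ℕ → α → ℝ} {D0 D1 : α → ℕ} {Z : β → ℕ} (hY : ∀ z d, Measurable (Y z d))
    (hD0 : Measurable D0) (hD1 : Measurable D1) (hZ : Measurable Z) :
    RCT (P.prod Q) K (fun z d ω => Y z d ω.1) (fun ω => D0 ω.1) (fun ω => D1 ω.1)
      (fun ω => Z ω.2) := by
  have hind : IndepFun (Prod.fst : α × β → α) Prod.snd (P.prod Q) :=
    indepFun_prod measurable_id measurable_id
  have hcomap : ∀ {γ : Type} [MeasurableSpace γ] {f : α → γ}, Measurable f →
      MeasurableSpace.comap (fun ω : α × β => f ω.1) inferInstance ≤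
        MeasurableSpace.comap Prod.fst inferInstance := fun hf =>
    (hf.comp (comap_measurable Prod.fst)).comap_le
  refine indep_of_indep_of_le_left (indep_of_indep_of_le_right hind
    (hZ.comp (comap_measurable Prod.snd)).comap_le) ?_
  exact sup_le (sup_le (iSup₂_le fun z _ => iSup₂_le fun d _ => hcomap (hY z d)) (hcomap hD0))
    (hcomap hD1)

/-- sharp characterization of the response-type probabilities:
any nonnegative vector `p` summing to one and matching the observed
propensity-score marginals is realized by some model satisfying Assumption RCT
that induces the observed data distribution `μ` of `(Y,D,Z)` (where `Y` is
matched only on the events `{D = d}`, `d ∈ {1,…,K}`). -/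
theorem response_type_sharp_characterization
    (K : ℕ) (hK : 1 ≤ K)
    (μ : Measure (ℝ × ℕ × ℕ)) [IsProbabilityMeasure μ]
    (hsupp : μ {x | x.2.1 ≤ K ∧ x.2.2 ≤ 1} = 1)
    (hZpos : 0 < μ {x | x.2.2 = 1}) (hZlt : μ {x | x.2.2 = 1} < 1)
    (p : ℕ × ℕ → ℝ)
    (hp0 : ∀ t ∈ Finset.range (K + 1) ×ˢ Finset.range (K + 1), 0 ≤ p t)
    (hp1 : ∑ t ∈ Finset.range (K + 1) ×ˢ Finset.range (K + 1), p t = 1)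
    (hmarg1 : ∀ d ≤ K,
      ((μ[|{x | x.2.2 = 1}]) {x | x.2.1 = d}).toReal
        = ∑ d' ∈ Finset.range (K + 1), p (d', d))
    (hmarg0 : ∀ d ≤ K,
      ((μ[|{x | x.2.2 = 0}]) {x | x.2.1 = d}).toReal
        = ∑ d' ∈ Finset.range (K + 1), p (d, d')) :
    ∃ (Ω' : Type) (m : MeasurableSpace Ω') (P : @Measure Ω' m),
      @IsProbabilityMeasure Ω' m P ∧
      ∃ (Y : ℕ → ℕ → Ω' → ℝ) (D0 D1 Zv : Ω' → ℕ),
        (@Measurable Ω' ℕ m inferInstance Zv) ∧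
        (@Measurable Ω' ℕ m inferInstance D0) ∧
        (@Measurable Ω' ℕ m inferInstance D1) ∧
        (∀ z ≤ 1, ∀ d, 1 ≤ d → d ≤ K → @Measurable Ω' ℝ m inferInstance (Y z d)) ∧
        (∀ ω, Zv ω ≤ 1) ∧ (∀ ω, D0 ω ≤ K) ∧ (∀ ω, D1 ω ≤ K) ∧
        @RCT Ω' m P K Y D0 D1 Zv ∧
        (∀ d ≤ K, ∀ d' ≤ K, (P {ω | D0 ω = d ∧ D1 ω = d'}).toReal = p (d, d')) ∧
        (∀ d ≤ K, ∀ z ≤ 1,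
          P {ω | Dreal Zv D0 D1 ω = d ∧ Zv ω = z} = μ {x | x.2.1 = d ∧ x.2.2 = z}) ∧
        (∀ d, 1 ≤ d → d ≤ K → ∀ z ≤ 1, ∀ y : ℝ,
          P {ω | Yreal K Zv D0 D1 Y ω ≤ y ∧ Dreal Zv D0 D1 ω = d ∧ Zv ω = z}
            = μ {x | x.1 ≤ y ∧ x.2.1 = d ∧ x.2.2 = z}) := by
  classical
  have hmeas : ∀ d z : ℕ, MeasurableSet {x : ℝ × ℕ × ℕ | x.2.1 = d ∧ x.2.2 = z} := fun d z =>
    measurable_snd (MeasurableSet.of_discrete (s := {w : ℕ × ℕ | w.1 = d ∧ w.2 = z}))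
  have hmeasZ : ∀ z : ℕ, MeasurableSet {x : ℝ × ℕ × ℕ | x.2.2 = z} := fun z =>
    measurable_snd (MeasurableSet.of_discrete (s := {w : ℕ × ℕ | w.2 = z}))
  have hsuppZ : ∀ᵐ x ∂μ, x.2.2 ≤ 1 := by
    have h : ∀ᵐ x ∂μ, x.2.1 ≤ K ∧ x.2.2 ≤ 1 := by
      rw [← prob_compl_eq_zero_iff] at hsupp
      · exact hsupp
      · exact measurable_snd
          (MeasurableSet.of_discrete (s := {w : ℕ × ℕ | w.1 ≤ K ∧ w.2 ≤ 1}))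
    exact h.mono fun x hx => hx.2
  choose κ hκ hκeq using fun i : ℕ × ℕ => exists_isProbabilityMeasure_mul_eq_inter μ
    (measurable_fst : Measurable (Prod.fst : ℝ × ℕ × ℕ → ℝ)) (hmeas i.2 i.1)
  set T := Finset.range (K + 1) ×ˢ Finset.range (K + 1)
  have : IsProbabilityMeasure (weightedDirac T p) := isProbabilityMeasure_weightedDirac hp0 hp1
  have hZm : Measurable (fun x : ℝ × ℕ × ℕ => x.2.2) := by fun_prop
  have : IsProbabilityMeasure (μ.map fun x => x.2.2) :=
    Measure.isProbabilityMeasure_map hZm.aemeasurable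
  have hζeq : ∀ z ≤ 1, (μ.map fun x => x.2.2) {w | min w 1 = z} = μ {x | x.2.2 = z} := by
    intro z hz
    rw [Measure.map_apply hZm MeasurableSet.of_discrete]
    refine measure_congr (Filter.eventuallyEq_set.2 ?_)
    filter_upwards [hsuppZ] with x hx
    simp [min_eq_left hx]
  have hlayer : ∀ d ≤ K, ∀ z ≤ 1,
      weightedDirac T p {t | responseLayer z (min t.1 K, min t.2 K) = d} *
        (μ.map fun x => x.2.2) {w | min w 1 = z} = μ {x | x.2.1 = d ∧ x.2.2 = z} := by
    intro d hd z hz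
    have hcond : weightedDirac T p {t | responseLayer z (min t.1 K, min t.2 K) = d} =
        (μ[|{x | x.2.2 = z}]) {x | x.2.1 = d} := by
      rw [weightedDirac_responseLayer hp0 hd]
      interval_cases z
      · rw [if_pos rfl, ← hmarg0 d hd, ENNReal.ofReal_toReal (measure_ne_top _ _)]
      · rw [if_neg one_ne_zero, ← hmarg1 d hd, ENNReal.ofReal_toReal (measure_ne_top _ _)]
    rw [hζeq z hz, hcond, cond_mul_eq_inter (hmeasZ z)]
    congr 1
    ext x
    exact and_comm
  obtain ⟨ρ, hρ⟩ : ∃ ρ, ρ = Measure.infinitePi κ := ⟨_, rfl⟩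
  obtain ⟨ν, hν⟩ : ∃ ν, ν = weightedDirac T p := ⟨_, rfl⟩
  obtain ⟨ζ, hζ⟩ : ∃ ζ, ζ = μ.map fun x => x.2.2 := ⟨_, rfl⟩
  have : IsProbabilityMeasure ρ := hρ ▸ inferInstance
  have : IsProbabilityMeasure ν := hν ▸ inferInstance
  have : IsProbabilityMeasure ζ := hζ ▸ inferInstance
  simp only [← hν, ← hζ] at hlayer
  have hRCT := RCT_of_prod (ρ.prod ν) ζ K
    (Y := fun z d ω => ω.1 (z, d)) (D0 := fun ω => min ω.2.1 K) (D1 := fun ω => min ω.2.2 K)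
    (Z := fun w => min w 1) (fun z d => by fun_prop) (by fun_prop) (by fun_prop) (by fun_prop)
  have hDreal : ∀ (ω : ((ℕ × ℕ → ℝ) × ℕ × ℕ) × ℕ) {z : ℕ}, z ≤ 1 → min ω.2 1 = z →
      Dreal (fun ω : ((ℕ × ℕ → ℝ) × ℕ × ℕ) × ℕ => min ω.2 1) (fun ω => min ω.1.2.1 K)
        (fun ω => min ω.1.2.2 K) ω = responseLayer z (min ω.1.2.1 K, min ω.1.2.2 K) :=
    fun ω z hz hZ => Dreal_eq_responseLayer
      (Z := fun ω : ((ℕ × ℕ → ℝ) × ℕ × ℕ) × ℕ => min ω.2 1) hz hZ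
  refine ⟨((ℕ × ℕ → ℝ) × ℕ × ℕ) × ℕ, Prod.instMeasurableSpace, (ρ.prod ν).prod ζ, inferInstance,
    fun z d ω => ω.1.1 (z, d), fun ω => min ω.1.2.1 K, fun ω => min ω.1.2.2 K,
    fun ω => min ω.2 1, by fun_prop, by fun_prop, by fun_prop,
    fun z _ d _ _ => by fun_prop, fun ω => min_le_right _ _, fun ω => min_le_right _ _,
    fun ω => min_le_right _ _, ?_, ?_, ?_, ?_⟩
  · exact hRCT
  · intro d hd d' hd'
    have hset : {ω : ((ℕ × ℕ → ℝ) × ℕ × ℕ) × ℕ | min ω.1.2.1 K = d ∧ min ω.1.2.2 K = d'} =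
        (Set.univ ×ˢ {t : ℕ × ℕ | min t.1 K = d ∧ min t.2 K = d'}) ×ˢ Set.univ := by
      ext ω; simp
    have hmem : (d, d') ∈ T := by simp [T]; omega
    have hfilter : {t ∈ T | t ∈ {t : ℕ × ℕ | min t.1 K = d ∧ min t.2 K = d'}} = {(d, d')} := by
      ext ⟨a, b⟩
      simp [T]
      omega
    rw [hset, Measure.prod_prod, Measure.prod_prod, measure_univ, measure_univ, one_mul, mul_one, hν,
      weightedDirac_apply hp0, hfilter, Finset.sum_singleton, ENNReal.toReal_ofReal (hp0 _ hmem)]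
  · intro d hd z hz
    rw [← hlayer d hd z hz, ← one_mul (ν _),
      ← measure_univ (μ := ρ), ← Measure.prod_prod, ← Measure.prod_prod]
    congr 1
    ext ω
    simp only [Set.mem_ofPred_eq, Set.mem_prod, Set.mem_univ, true_and]
    refine and_congr_left fun hZ => ?_
    rw [hDreal ω hz hZ]
  · intro d hd1 hd z hz y
    have hκy : ρ {f | f (z, d) ≤ y} = κ (z, d) (Set.Iic y) := by
      rw [hρ, ← (measurePreserving_eval_infinitePi κ (z, d)).measure_preimage
        measurableSet_Iic.nullMeasurableSet]
      rfl
    have hμ : μ {x | x.1 ≤ y ∧ x.2.1 = d ∧ x.2.2 = z} = κ (z, d) (Set.Iic y) *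
        μ {x | x.2.1 = d ∧ x.2.2 = z} := by
      rw [hκeq (z, d) _ measurableSet_Iic]
      congr 1
      ext x
      exact and_comm
    rw [hμ, ← hlayer d hd z hz, ← mul_assoc, ← hκy, ← Measure.prod_prod, ← Measure.prod_prod]
    congr 1
    ext ω
    simp only [Set.mem_ofPred_eq, Set.mem_prod]
    rw [← and_assoc]
    refine and_congr_left fun hZ => ?_
    rw [← hDreal ω hz hZ]
    refine and_congr_left fun hD => ?_
    rw [Yreal_eq (Z := fun ω : ((ℕ × ℕ → ℝ) × ℕ × ℕ) × ℕ => min ω.2 1) (Finset.mem_Icc.2 ⟨hd1, hd⟩)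
      hz hZ hD]
end
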